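/- Let n ≥ 2, r ∈ (0, π/4), p ∈ Sⁿ and q = −p. For z, w ∈ Sⁿ with z ≠ w write a(z,w) = (w − z)/|w − z|. Then the set of pairs (z,w) ∈ Sⁿ × Sⁿ with z ≠ w satisfying both ∫_{B_{p,r}} g(z·F_{a(z,w)}(v)) π_z(F_{a(z,w)}(v)) dv = 0 and ∫_{B_{q,r}} g(z·F_{a(z,w)}(v)) π_z(F_{a(z,w)}(v)) dv = 0 is exactly {(p,q), (q,p)}. -/

import Mathlib

open MeasureTheory Real
open scoped RealInnerProductSpace

noncomputable section

/-- The unit sphere `Sⁿ ⊆ ℝ^{n+1}`. -/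
def sph (n : ℕ) : Set (EuclideanSpace ℝ (Fin (n + 1))) := Metric.sphere 0 1

/-- Reflection `R_a(z) = z - 2(z·a)a` across the hyperplane `a^⊥`. -/
def sphRefl (n : ℕ) (a z : EuclideanSpace ℝ (Fin (n + 1))) : EuclideanSpace ℝ (Fin (n + 1)) :=
  z - (2 * ⟪z, a⟫) • a

/-- The folding map `F_a` : reflect the open half-sphere `{z·a > 0}` onto `{z·a < 0}`. -/
def fold (n : ℕ) (a z : EuclideanSpace ℝ (Fin (n + 1))) : EuclideanSpace ℝ (Fin (n + 1)) :=
  if 0 < ⟪z, a⟫ then sphRefl n a z else z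

/-- Projection `π_z(w) = w - (w·z)z` onto the tangent space `z^⊥`. -/
def proj (n : ℕ) (z w : EuclideanSpace ℝ (Fin (n + 1))) : EuclideanSpace ℝ (Fin (n + 1)) :=
  w - ⟪w, z⟫ • z

/-- The open geodesic ball `B_{p,r}` on the unit sphere: points of the sphere at geodesic
(angular) distance `arccos (p·v) < r` from `p`. -/
def gball (n : ℕ) (p : EuclideanSpace ℝ (Fin (n + 1))) (r : ℝ) :
    Set (EuclideanSpace ℝ (Fin (n + 1))) :=
  {v | v ∈ sph n ∧ Real.arccos ⟪p, v⟫ < r}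

/-- `G(t) = ∫₀ᵗ g(s) ds`. -/
def Gfun (g : ℝ → ℝ) (t : ℝ) : ℝ := ∫ s in (0:ℝ)..t, g s


abbrev EE (n : ℕ) := EuclideanSpace ℝ (Fin (n + 1))

instance factFinrank (n : ℕ) : Fact (Module.finrank ℝ (EE n) = n + 1) := ⟨by simp⟩

lemma hausdorff_perp_haar (n : ℕ) (v : EE n) (hv : v ≠ 0) :
    Measure.IsAddHaarMeasure (μH[(n:ℝ)] : Measure (ℝ ∙ v)ᗮ) := by
  have h := MeasureTheory.isAddHaarMeasure_hausdorffMeasure (E := (ℝ ∙ v)ᗮ)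
  rwa [Submodule.finrank_orthogonal_span_singleton (n := n) hv] at h

lemma lt_cos_of_arccos {t r : ℝ} (hr : r ∈ Set.Ioo 0 (π / 4)) :
    Real.arccos t < r ↔ Real.cos r < t := by
  have hr0 := hr.1
  have hr1 := hr.2
  have hpi := Real.pi_pos
  have hc : Real.cos r < 1 := by
    have := Real.cos_lt_cos_of_nonneg_of_le_pi (le_refl 0) (by linarith : r ≤ π) hr0
    simpa using this
  constructor
  · intro h
    by_contra hcon
    push Not at hcon
    have := Real.arccos_le_arccos hcon
    rw [Real.arccos_cos hr0.le (by linarith)] at this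
    linarith
  · intro h
    rcases le_or_gt t 1 with ht | ht
    · have := Real.arccos_lt_arccos (Real.neg_one_le_cos r) h ht
      rwa [Real.arccos_cos hr0.le (by linarith)] at this
    · rw [Real.arccos_eq_zero.2 ht.le]; exact hr0

lemma mem_gball {n : ℕ} {p v : EE n} {r : ℝ} (hr : r ∈ Set.Ioo 0 (π / 4)) :
    v ∈ gball n p r ↔ ‖v‖ = 1 ∧ Real.cos r < ⟪p, v⟫ := by
  simp [gball, sph, lt_cos_of_arccos hr]

lemma cos_bd {r : ℝ} (hr : r ∈ Set.Ioo 0 (π / 4)) :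
    0 < Real.cos r ∧ 1 < 2 * Real.cos r ^ 2 := by
  have hr0 := hr.1
  have hr1 := hr.2
  have hpi := Real.pi_pos
  have h0 : 0 < Real.cos r := Real.cos_pos_of_mem_Ioo ⟨by linarith, by linarith⟩
  refine ⟨h0, ?_⟩
  have : 0 < Real.cos (2 * r) := Real.cos_pos_of_mem_Ioo ⟨by linarith, by linarith⟩
  rw [Real.cos_two_mul] at this
  linarith

lemma normalize_lip {n : ℕ} (x y : EE n) (hx : 1 ≤ ‖x‖) (hy : 1 ≤ ‖y‖) :
    ‖‖x‖⁻¹ • x - ‖y‖⁻¹ • y‖ ≤ 2 * ‖x - y‖ := by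
  have hx0 : 0 < ‖x‖ := by linarith
  have hy0 : 0 < ‖y‖ := by linarith
  have e : ‖x‖⁻¹ • x - ‖y‖⁻¹ • y = ‖x‖⁻¹ • (x - y) + (‖x‖⁻¹ - ‖y‖⁻¹) • y := by
    module
  rw [e]
  refine (norm_add_le _ _).trans ?_
  rw [norm_smul, norm_smul]
  have h1 : ‖‖x‖⁻¹‖ ≤ 1 := by
    rw [Real.norm_of_nonneg (by positivity)]; exact inv_le_one_of_one_le₀ hx
  have h2 : ‖‖x‖⁻¹ - ‖y‖⁻¹‖ * ‖y‖ = ‖x‖⁻¹ * |‖y‖ - ‖x‖| := by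
    have : ‖x‖⁻¹ - ‖y‖⁻¹ = ‖x‖⁻¹ * ‖y‖⁻¹ * (‖y‖ - ‖x‖) := by field_simp
    rw [this, Real.norm_eq_abs, abs_mul, abs_of_pos (by positivity)]
    field_simp
  rw [h2]
  have h3 : |‖y‖ - ‖x‖| ≤ ‖x - y‖ := by
    rw [norm_sub_rev]; exact abs_norm_sub_norm_le y x
  have h4 : ‖x‖⁻¹ ≤ 1 := inv_le_one_of_one_le₀ hx
  have h5 : ‖x‖⁻¹ * |‖y‖ - ‖x‖| ≤ 1 * ‖x - y‖ := by gcongr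
  have h6 : ‖‖x‖⁻¹‖ * ‖x - y‖ ≤ 1 * ‖x - y‖ := by gcongr
  linarith

lemma perp_inner {n : ℕ} {p : EE n} (y : (ℝ ∙ p)ᗮ) : ⟪p, (y : EE n)⟫ = 0 :=
  Submodule.mem_orthogonal_singleton_iff_inner_right.1 y.2

lemma gball_finite {n : ℕ} {p : EE n} (hp : ‖p‖ = 1) {r : ℝ} (hr : r ∈ Set.Ioo 0 (π / 4)) :
    (μH[(n:ℝ)] : Measure (EE n)) (gball n p r) < ⊤ := by
  have hp0 : p ≠ 0 := by rintro rfl; simp at hp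
  have := hausdorff_perp_haar n p hp0
  obtain ⟨hc, -⟩ := cos_bd hr
  have hpp : ⟪p, p⟫ = (1:ℝ) := by rw [real_inner_self_eq_norm_sq, hp]; norm_num
  let f : (ℝ ∙ p)ᗮ → EE n := fun y => ‖p + (y : EE n)‖⁻¹ • (p + (y : EE n))
  have hf1 : ∀ y : (ℝ ∙ p)ᗮ, 1 ≤ ‖p + (y : EE n)‖ := by
    intro y
    have h : ⟪p, p + (y : EE n)⟫ = (1:ℝ) := by rw [inner_add_right, perp_inner, hpp]; ring
    have := real_inner_le_norm p (p + (y : EE n))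
    rw [h, hp] at this; linarith
  have hf : LipschitzWith 2 f := by
    apply LipschitzWith.of_dist_le_mul
    intro x y
    rw [dist_eq_norm, dist_eq_norm]
    refine (normalize_lip _ _ (hf1 x) (hf1 y)).trans (le_of_eq ?_)
    simp
  have hsub : gball n p r ⊆ f '' (Metric.closedBall 0 ((Real.cos r)⁻¹ + 1)) := by
    intro v hv
    rw [mem_gball hr] at hv
    obtain ⟨hv1, hv2⟩ := hv
    set t : ℝ := ⟪p, v⟫ with ht
    have ht0 : 0 < t := hc.trans hv2
    have hy : t⁻¹ • v - p ∈ (ℝ ∙ p)ᗮ := by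
      rw [Submodule.mem_orthogonal_singleton_iff_inner_right, inner_sub_right, inner_smul_right,
        hpp, ← ht]
      field_simp; ring
    refine ⟨⟨_, hy⟩, ?_, ?_⟩
    · rw [mem_closedBall_zero_iff]
      change ‖t⁻¹ • v - p‖ ≤ _
      refine (norm_sub_le _ _).trans ?_
      rw [norm_smul, hv1, hp, Real.norm_of_nonneg (by positivity), mul_one]
      gcongr
    · change ‖p + (t⁻¹ • v - p)‖⁻¹ • (p + (t⁻¹ • v - p)) = v
      rw [add_sub_cancel, norm_smul, hv1, Real.norm_of_nonneg (by positivity), mul_one, inv_inv,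
        smul_smul, mul_inv_cancel₀ ht0.ne', one_smul]
  calc _ ≤ (μH[(n:ℝ)] : Measure (EE n)) (f '' (Metric.closedBall 0 ((Real.cos r)⁻¹ + 1))) :=
        measure_mono hsub
    _ ≤ _ := hf.hausdorffMeasure_image_le (by positivity) _
    _ < ⊤ := by
      apply ENNReal.mul_lt_top
      · exact ENNReal.rpow_lt_top_of_nonneg (by positivity) (by simp)
      · exact (isCompact_closedBall _ _).measure_lt_top

lemma open_pos {n : ℕ} {U : Set (EE n)} (hU : IsOpen U) {v : EE n} (hv : v ∈ U) (hv1 : ‖v‖ = 1)  :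
    0 < (μH[(n:ℝ)] : Measure (EE n)) (U ∩ {x | ‖x‖ = 1}) := by
  have hp0 : v ≠ 0 := by rintro rfl; simp at hv1
  have := hausdorff_perp_haar n v hp0
  let P := (ℝ ∙ v)ᗮ.orthogonalProjectionOnto
  have hP : LipschitzWith 1 P := Submodule.lipschitzWith_orthogonalProjectionOnto _
  let s : (ℝ ∙ v)ᗮ → EE n := fun y => √(1 - ‖y‖^2) • v + (y : EE n)
  have hs : Continuous s := by fun_prop
  have hs0 : s 0 = v := by simp [s]
  let W := s ⁻¹' U ∩ Metric.ball 0 1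
  have hW : IsOpen W := (hU.preimage hs).inter Metric.isOpen_ball
  have hWn : W.Nonempty := ⟨0, by simp [W, hs0, hv]⟩
  have hpos : 0 < (μH[(n:ℝ)] : Measure (ℝ ∙ v)ᗮ) W := hW.measure_pos _ hWn
  refine hpos.trans_le ?_
  have hsub : W ⊆ P '' (U ∩ {x | ‖x‖ = 1}) := by
    rintro y ⟨hy1, hy2⟩
    rw [mem_ball_zero_iff] at hy2
    refine ⟨s y, ⟨hy1, ?_⟩, ?_⟩
    · have h : ‖s y‖ ^ 2 = 1 := by
        simp only [s]
        rw [norm_add_sq_real, norm_smul, inner_smul_left, perp_inner, hv1,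
          Real.norm_of_nonneg (Real.sqrt_nonneg _), mul_one, Real.sq_sqrt (by nlinarith [norm_nonneg y])]
        simp
      have := norm_nonneg (s y)
      change ‖s y‖ = 1
      nlinarith
    · simp only [s, map_add, map_smul, P]
      rw [Submodule.orthogonalProjectionOnto_orthogonalComplement_singleton_eq_zero]
      simp
  have := hP.hausdorffMeasure_image_le (d := (n:ℝ)) (by positivity) (U ∩ {x | ‖x‖ = 1})
  simp only [ENNReal.coe_one, ENNReal.one_rpow, one_mul] at this
  exact (measure_mono hsub).trans this

def rf {n : ℕ} (e : EE n) : EE n ≃ₗᵢ[ℝ] EE n := (ℝ ∙ e)ᗮ.reflection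

lemma rf_apply {n : ℕ} (e v : EE n) : rf e v = v - (2 * ⟪e, v⟫ / ‖e‖ ^ 2) • e := by
  rw [rf, Submodule.reflection_orthogonal_apply, Submodule.reflection_singleton_apply]
  simp only [RCLike.ofReal_real_eq_id, id, neg_sub, smul_smul, two_smul]
  module

lemma rf_rf {n : ℕ} (e v : EE n) : rf e (rf e v) = v := Submodule.reflection_reflection _ _

lemma gball_meas {n : ℕ} (p : EE n) {r : ℝ} (hr : r ∈ Set.Ioo 0 (π / 4)) :
    MeasurableSet (gball n p r) := by
  have : gball n p r = {v | ‖v‖ = 1} ∩ {v | Real.cos r < ⟪p, v⟫} := by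
    ext v; rw [mem_gball hr]; rfl
  rw [this]
  refine (IsClosed.measurableSet ?_).inter (IsOpen.measurableSet ?_)
  · exact isClosed_eq continuous_norm continuous_const
  · exact isOpen_lt continuous_const (by fun_prop)

lemma integ {n : ℕ} {F : Type*} [NormedAddCommGroup F] [SecondCountableTopology F] {p : EE n}
    (hp : ‖p‖ = 1) {r : ℝ}
    (hr : r ∈ Set.Ioo 0 (π / 4)) {h : EE n → F} (hh : Continuous h) :
    IntegrableOn h (gball n p r) (μH[(n:ℝ)]) := by
  obtain ⟨C, hC⟩ := (isCompact_sphere (0 : EE n) 1).exists_bound_of_continuousOn hh.continuousOn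
  refine IntegrableOn.of_bound (gball_finite hp hr) (hh.aestronglyMeasurable) C ?_
  refine (ae_restrict_iff' (gball_meas p hr)).2 (Filter.Eventually.of_forall fun v hv => ?_)
  exact hC v hv.1

lemma antisymm_int {n : ℕ} {F : Type*} [NormedAddCommGroup F] [NormedSpace ℝ F]
    (T : EE n ≃ₗᵢ[ℝ] EE n) (A : Set (EE n)) (hA : MeasurableSet A) (hTA : T ⁻¹' A = A)
    (h : EE n → F) (hh : ∀ v ∈ A, h (T v) = - h v) :
    ∫ v in A, h v ∂μH[(n:ℝ)] = 0 := by
  have hT : MeasurePreserving T (μH[(n:ℝ)]) (μH[(n:ℝ)]) :=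
    T.toIsometryEquiv.measurePreserving_hausdorffMeasure _
  have h1 := hT.setIntegral_preimage_emb T.toHomeomorph.measurableEmbedding h A
  rw [hTA, setIntegral_congr_fun hA hh, integral_neg] at h1
  have h2 : (2:ℝ) • ∫ v in A, h v ∂μH[(n:ℝ)] = 0 := by
    rw [two_smul]; nth_rewrite 1 [← h1]; simp
  exact (smul_eq_zero.1 h2).resolve_left two_ne_zero

lemma exists_pt {n : ℕ} (hn : 2 ≤ n) {p e : EE n} (hp : ‖p‖ = 1) {r : ℝ}
    (hr : r ∈ Set.Ioo 0 (π / 4)) (hpe : 0 < ⟪p, e⟫) :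
    ∃ v : EE n, ‖v‖ = 1 ∧ Real.cos r < ⟪p, v⟫ ∧ ⟪p, rf e v⟫ < Real.cos r := by
  have hp0 : p ≠ 0 := by rintro rfl; simp at hp
  have he0 : e ≠ 0 := by rintro rfl; simp at hpe
  have hen : 0 < ‖e‖ := norm_pos_iff.2 he0
  have hpp : ⟪p, p⟫ = (1:ℝ) := by rw [real_inner_self_eq_norm_sq, hp]; norm_num
  obtain ⟨hc, -⟩ := cos_bd hr
  have hfr := Submodule.finrank_orthogonal_span_singleton (𝕜 := ℝ) (n := n) hp0
  have hnt : Nontrivial (ℝ ∙ p)ᗮ := by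
    apply Module.nontrivial_of_finrank_pos (R := ℝ); omega
  obtain ⟨u0, hu0⟩ := exists_norm_eq (ℝ ∙ p)ᗮ (zero_le_one)
  obtain ⟨u, hu1, hu2, hu3⟩ : ∃ u : EE n, ‖u‖ = 1 ∧ ⟪p, u⟫ = (0:ℝ) ∧ (0:ℝ) ≤ ⟪e, u⟫ := by
    rcases le_total (0:ℝ) ⟪e, (u0 : EE n)⟫ with h | h
    · exact ⟨u0, hu0, perp_inner u0, h⟩
    · refine ⟨-u0, by simpa using hu0, ?_, ?_⟩
      · rw [inner_neg_right, perp_inner]; simp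
      · rw [inner_neg_right]; linarith
  have huu : ⟪u, u⟫ = (1:ℝ) := by rw [real_inner_self_eq_norm_sq, hu1]; norm_num
  let V : ℝ → EE n := fun s => Real.cos s • p + Real.sin s • u
  have hVc : Continuous V := by fun_prop
  have hVp : ∀ s, ⟪p, V s⟫ = Real.cos s := by
    intro s; simp [V, inner_add_right, inner_smul_right, hpp, hu2, hp]
  have hVn : ∀ s, ‖V s‖ = 1 := by
    intro s
    have : ‖V s‖ ^ 2 = 1 := by
      simp only [V]
      rw [norm_add_sq_real, norm_smul, norm_smul, inner_smul_left, inner_smul_right, hu2, hp, hu1]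
      simp
    have := norm_nonneg (V s)
    nlinarith
  have hlim : ⟪p, rf e (V r)⟫ < Real.cos r := by
    rw [rf_apply, inner_sub_right, inner_smul_right, hVp]
    have h1 : (0:ℝ) < ⟪e, V r⟫ := by
      simp only [V, inner_add_right, inner_smul_right]
      rw [real_inner_comm p e]
      have : 0 ≤ Real.sin r := Real.sin_nonneg_of_nonneg_of_le_pi hr.1.le
        (by linarith [hr.2, Real.pi_pos])
      positivity
    have : 0 < 2 * ⟪e, V r⟫ / ‖e‖ ^ 2 * ⟪p, e⟫ := by positivity
    linarith
  have hcont : Continuous fun s => (⟪p, rf e (V s)⟫ : ℝ) := by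
    have := (rf e).continuous
    fun_prop
  have hev : ∀ᶠ s in nhdsWithin r (Set.Iio r), ⟪p, rf e (V s)⟫ < Real.cos r :=
    nhdsWithin_le_nhds (hcont.continuousAt.eventually_lt_const hlim)
  have hev2 : ∀ᶠ s in nhdsWithin r (Set.Iio r), s ∈ Set.Ioo 0 r :=
    Ioo_mem_nhdsLT hr.1
  obtain ⟨s, hs1, hs2⟩ := (hev.and hev2).exists
  refine ⟨V s, hVn s, ?_, hs1⟩
  rw [hVp]
  exact Real.cos_lt_cos_of_nonneg_of_le_pi hs2.1.le (by linarith [hr.2, Real.pi_pos]) hs2.2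

lemma pos_int {n : ℕ} {p : EE n} (hp : ‖p‖ = 1) {r : ℝ} (hr : r ∈ Set.Ioo 0 (π / 4))
    {A : Set (EE n)} (hA : MeasurableSet A) (hAB : A ⊆ gball n p r) {f : EE n → ℝ}
    (hf : Continuous f) (hpos : ∀ v ∈ A, 0 < f v) {U : Set (EE n)} (hU : IsOpen U)
    {v : EE n} (hvU : v ∈ U) (hv : ‖v‖ = 1) (hUA : U ∩ {x | ‖x‖ = 1} ⊆ A) :
    0 < ∫ v in A, f v ∂μH[(n:ℝ)] := by
  rw [setIntegral_pos_iff_support_of_nonneg_ae]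
  · refine (open_pos hU hvU hv).trans_le (measure_mono ?_)
    intro x hx
    exact ⟨(hpos x (hUA hx)).ne', hUA hx⟩
  · exact (ae_restrict_iff' hA).2 (Filter.Eventually.of_forall fun v hv => (hpos v hv).le)
  · exact (integ hp hr hf).mono_set hAB

lemma key {n : ℕ} (hn : 2 ≤ n) {p e : EE n} (hp : ‖p‖ = 1) {r : ℝ}
    (hr : r ∈ Set.Ioo 0 (π / 4)) (hpe : 0 < ⟪p, e⟫) {f : EE n → ℝ} (hf : Continuous f)
    (hanti : ∀ v, f (rf e v) = - f v) (hpos : ∀ v, ‖v‖ = 1 → 0 < ⟪e, v⟫ → 0 < f v) :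
    0 < ∫ v in gball n p r, f v ∂μH[(n:ℝ)] := by
  have he0 : e ≠ 0 := by rintro rfl; simp at hpe
  have hen : 0 < ‖e‖ := norm_pos_iff.2 he0
  set B := gball n p r with hB
  have hBm : MeasurableSet B := gball_meas p hr
  set B' := rf e ⁻¹' B with hB'
  have hB'm : MeasurableSet B' := (rf e).continuous.measurable hBm
  rw [← integral_inter_add_sdiff hB'm (integ hp hr hf)]
  rw [antisymm_int (rf e) (B ∩ B') (hBm.inter hB'm) _ f (fun v _ => hanti v), zero_add]
  · obtain ⟨v, hv1, hv2, hv3⟩ := exists_pt hn hp hr hpe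
    have hc := (rf e).continuous
    refine pos_int hp hr (hBm.diff hB'm) Set.sdiff_subset hf ?_
      (U := {v | Real.cos r < ⟪p, v⟫} ∩ {v | ⟪p, rf e v⟫ < Real.cos r}) ?_ ⟨hv2, hv3⟩ hv1 ?_
    · rintro x ⟨hx1, hx2⟩
      rw [hB, mem_gball hr] at hx1
      refine hpos x hx1.1 ?_
      by_contra hcon
      push Not at hcon
      apply hx2
      change rf e x ∈ gball n p r
      rw [mem_gball hr, LinearIsometryEquiv.norm_map, rf_apply, inner_sub_right, inner_smul_right]
      refine ⟨hx1.1, ?_⟩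
      have : 2 * ⟪e, x⟫ / ‖e‖ ^ 2 * ⟪p, e⟫ ≤ 0 := by
        apply mul_nonpos_of_nonpos_of_nonneg _ hpe.le
        apply div_nonpos_of_nonpos_of_nonneg <;> [linarith; positivity]
      linarith [hx1.2]
    · exact (isOpen_lt continuous_const (by fun_prop)).inter
        (isOpen_lt (by fun_prop) continuous_const)
    · rintro x ⟨⟨hx1, hx2⟩, hx3⟩
      refine ⟨(mem_gball hr).2 ⟨hx3, hx1⟩, fun h => ?_⟩
      have := ((mem_gball hr).1 h).2
      exact lt_asymm this hx2
  · rw [Set.preimage_inter, hB', ← Set.preimage_comp]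
    have : (rf e ∘ rf e : EE n → EE n) = id := by ext1 v; exact rf_rf e v
    rw [this, Set.preimage_id, Set.inter_comm]

lemma fold_eq {n : ℕ} (a v : EE n) : fold n a v = v - (2 * max ⟪v, a⟫ 0) • a := by
  unfold fold sphRefl
  split_ifs with h
  · rw [max_eq_left h.le]
  · rw [max_eq_right (not_lt.1 h)]; simp

lemma fold_cont {n : ℕ} (a : EE n) : Continuous (fold n a) := by
  have : fold n a = fun v => v - (2 * max ⟪v, a⟫ 0) • a := funext (fold_eq a)
  rw [this]; fun_prop

lemma self1 {n : ℕ} {a : EE n} (ha : ‖a‖ = 1) : ⟪a, a⟫ = (1:ℝ) := by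
  rw [real_inner_self_eq_norm_sq, ha]; norm_num

lemma fold_inner_a {n : ℕ} {a : EE n} (ha : ‖a‖ = 1) (v : EE n) :
    ⟪a, fold n a v⟫ = -|⟪a, v⟫| := by
  rw [fold_eq, inner_sub_right, inner_smul_right, self1 ha, real_inner_comm a v]
  rcases le_total 0 (⟪a, v⟫ : ℝ) with h | h
  · rw [max_eq_left h, abs_of_nonneg h]; ring
  · rw [max_eq_right h, abs_of_nonpos h]; ring

lemma fold_inner_perp {n : ℕ} {a b : EE n} (hab : ⟪b, a⟫ = (0:ℝ)) (v : EE n) :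
    ⟪b, fold n a v⟫ = (⟪b, v⟫ : ℝ) := by
  rw [fold_eq, inner_sub_right, inner_smul_right, hab]; ring

lemma fold_norm {n : ℕ} {a : EE n} (ha : ‖a‖ = 1) (v : EE n) : ‖fold n a v‖ = ‖v‖ := by
  have h : fold n a v = v ∨ fold n a v = rf a v := by
    unfold fold sphRefl
    split_ifs
    · right; rw [rf_apply, ha, real_inner_comm]; simp
    · left; rfl
  rcases h with h | h
  · rw [h]
  · rw [h, LinearIsometryEquiv.norm_map]

lemma strict_in {n : ℕ} {z u e : EE n} (hz : ‖z‖ = 1) (hu : ‖u‖ = 1) (hze : ⟪z, e⟫ = (0:ℝ))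
    (h : (⟪e, u⟫ : ℝ) ≠ 0) : (⟪z, u⟫ : ℝ) ∈ Set.Ioo (-1:ℝ) 1 := by
  have hy : u - (⟪z, u⟫ : ℝ) • z ≠ 0 := by
    intro h0
    apply h
    have : (⟪e, u - (⟪z, u⟫ : ℝ) • z⟫ : ℝ) = 0 := by rw [h0, inner_zero_right]
    rw [inner_sub_right, inner_smul_right, real_inner_comm z e, hze] at this
    linarith
  have h2 : 0 < ‖u - (⟪z, u⟫ : ℝ) • z‖ ^ 2 := by
    have := norm_pos_iff.2 hy
    positivity
  rw [norm_sub_sq_real, inner_smul_right, norm_smul, hz, hu, real_inner_comm z u, mul_one,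
    Real.norm_eq_abs, sq_abs] at h2
  constructor <;> nlinarith

lemma acute {n : ℕ} {p x v : EE n} (hp : ‖p‖ = 1) (hv : ‖v‖ = 1) (hx0 : x ≠ 0)
    (hx : 0 ≤ (⟪p, x⟫ : ℝ)) (hx2 : ‖x‖ ^ 2 ≤ 2 * (⟪p, x⟫ : ℝ) ^ 2)
    (hpv : 0 < (⟪p, v⟫ : ℝ)) (hpv2 : 1 < 2 * (⟪p, v⟫ : ℝ) ^ 2) : 0 < (⟪x, v⟫ : ℝ) := by
  have hxn : 0 < ‖x‖ := norm_pos_iff.2 hx0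
  set s : ℝ := ⟪p, x⟫ with hs
  set t : ℝ := ⟪p, v⟫ with ht
  have h1 : ‖x - s • p‖ ^ 2 = ‖x‖ ^ 2 - s ^ 2 := by
    rw [norm_sub_sq_real, inner_smul_right, norm_smul, hp, real_inner_comm p x, ← hs, mul_one,
      Real.norm_eq_abs, sq_abs]
    ring
  have h2 : ‖v - t • p‖ ^ 2 = 1 - t ^ 2 := by
    rw [norm_sub_sq_real, inner_smul_right, norm_smul, hp, real_inner_comm p v, ← ht, mul_one,
      Real.norm_eq_abs, sq_abs, hv]
    ring
  have h3 : (⟪x, v⟫ : ℝ) = s * t + ⟪x - s • p, v - t • p⟫ := by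
    simp only [inner_sub_left, inner_sub_right, inner_smul_left, inner_smul_right, self1 hp]
    rw [real_inner_comm p x, ← hs, ← ht]
    simp
  have h4 := abs_real_inner_le_norm (x - s • p) (v - t • p)
  have h5 := neg_abs_le (⟪x - s • p, v - t • p⟫ : ℝ)
  have hspos : 0 < s := by
    rcases hx.lt_or_eq with h | h
    · exact h
    · rw [← h] at hx2; nlinarith
  have h6 : ‖x - s • p‖ ≤ s := by
    apply le_of_sq_le_sq _ hx
    linarith
  have h7 : ‖v - t • p‖ < t := by
    apply lt_of_pow_lt_pow_left₀ 2 hpv.le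
    linarith
  have h8 : ‖x - s • p‖ * ‖v - t • p‖ < s * t :=
    (mul_le_mul_of_nonneg_right h6 (norm_nonneg _)).trans_lt (mul_lt_mul_of_pos_left h7 hspos)
  linarith

lemma rf_inner_self {n : ℕ} {e : EE n} (he : e ≠ 0) (v : EE n) :
    (⟪e, rf e v⟫ : ℝ) = - ⟪e, v⟫ := by
  have hen : 0 < ‖e‖ := norm_pos_iff.2 he
  rw [rf_apply, inner_sub_right, inner_smul_right, real_inner_self_eq_norm_sq]
  field_simp; ring

lemma rf_inner_perp {n : ℕ} {e z : EE n} (hze : ⟪z, e⟫ = (0:ℝ)) (v : EE n) :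
    (⟪z, rf e v⟫ : ℝ) = ⟪z, v⟫ := by
  rw [rf_apply, inner_sub_right, inner_smul_right, hze]; ring

lemma key2 {n : ℕ} (hn : 2 ≤ n) {p e z : EE n} (hp : ‖p‖ = 1) (hz : ‖z‖ = 1) {r : ℝ}
    (hr : r ∈ Set.Ioo 0 (π / 4)) (hpe : 0 < (⟪p, e⟫ : ℝ)) (hze : ⟪z, e⟫ = (0:ℝ))
    {g : ℝ → ℝ} (hg : Continuous g) (hg_pos : ∀ t ∈ Set.Ioo (-1:ℝ) 1, 0 < g t) :
    0 < ∫ v in gball n p r, g ⟪z, v⟫ * ⟪e, v⟫ ∂μH[(n:ℝ)] := by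
  have he0 : e ≠ 0 := by rintro rfl; simp at hpe
  refine key hn hp hr hpe (by fun_prop) ?_ ?_
  · intro v
    rw [rf_inner_self he0, rf_inner_perp hze]; ring
  · intro v hv h
    exact mul_pos (hg_pos _ (strict_in hz hv hze h.ne')) h

lemma key1 {n : ℕ} (hn : 2 ≤ n) {p e z a : EE n} (hp : ‖p‖ = 1) (hz : ‖z‖ = 1) (ha : ‖a‖ = 1)
    {r : ℝ}
    (hr : r ∈ Set.Ioo 0 (π / 4)) (hpe : 0 < (⟪p, e⟫ : ℝ)) (hze : ⟪z, e⟫ = (0:ℝ))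
    (hae : ⟪a, e⟫ = (0:ℝ))
    {g : ℝ → ℝ} (hg : Continuous g) (hg_pos : ∀ t ∈ Set.Ioo (-1:ℝ) 1, 0 < g t) :
    0 < ∫ v in gball n p r, g ⟪z, fold n a v⟫ * ⟪e, fold n a v⟫ ∂μH[(n:ℝ)] := by
  have he0 : e ≠ 0 := by rintro rfl; simp at hpe
  have hfc := fold_cont a
  have hea : ⟪e, a⟫ = (0:ℝ) := by rw [real_inner_comm]; exact hae
  have hcomm : ∀ v, fold n a (rf e v) = rf e (fold n a v) := by
    intro v
    rw [fold_eq, fold_eq, map_sub, map_smul, real_inner_comm, rf_inner_perp hae,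
      real_inner_comm]
    congr 2
    rw [rf_apply, hea]; simp
  refine key hn hp hr hpe (by fun_prop) ?_ ?_
  · intro v
    rw [hcomm, rf_inner_self he0, rf_inner_perp hze]; ring
  · intro v hv h
    rw [← fold_inner_perp hea] at h
    exact mul_pos (hg_pos _ (strict_in hz (by rw [fold_norm ha, hv]) hze h.ne')) h

lemma scal {n : ℕ} {p e z a : EE n} (hp : ‖p‖ = 1) {r : ℝ}
    (hr : r ∈ Set.Ioo 0 (π / 4)) (hze : ⟪z, e⟫ = (0:ℝ))
    {g : ℝ → ℝ} (hg : Continuous g)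
    (h0 : ∫ v in gball n p r, g ⟪z, fold n a v⟫ • proj n z (fold n a v) ∂μH[(n:ℝ)] = 0) :
    ∫ v in gball n p r, g ⟪z, fold n a v⟫ * ⟪e, fold n a v⟫ ∂μH[(n:ℝ)] = 0 := by
  have hfc := fold_cont a
  have hc : Continuous fun v => g ⟪z, fold n a v⟫ • proj n z (fold n a v) := by
    unfold proj; fun_prop
  have h := integral_inner (𝕜 := ℝ) (integ hp hr hc) e
  rw [h0, inner_zero_right] at h
  rw [← h]
  congr 1
  ext v
  rw [inner_smul_right, proj, inner_sub_right, inner_smul_right, real_inner_comm z e, hze]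
  ring

lemma planar {n : ℕ} (hn : 2 ≤ n) {p z a b : EE n} (hp : ‖p‖ = 1) (hz : ‖z‖ = 1) (ha : ‖a‖ = 1)
    {r : ℝ} (hr : r ∈ Set.Ioo 0 (π / 4)) (hb : b = z - (⟪z, a⟫ : ℝ) • a)
    {g : ℝ → ℝ} (hg : Continuous g) (hg_pos : ∀ t ∈ Set.Ioo (-1:ℝ) 1, 0 < g t)
    (h0 : ∫ v in gball n p r, g ⟪z, fold n a v⟫ • proj n z (fold n a v) ∂μH[(n:ℝ)] = 0) :
    p = (⟪p, a⟫ : ℝ) • a + ((⟪p, b⟫ : ℝ) / ‖b‖ ^ 2) • b := by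
  set e := p - ((⟪p, a⟫ : ℝ) • a + ((⟪p, b⟫ : ℝ) / ‖b‖ ^ 2) • b) with he
  have hba : ⟪b, a⟫ = (0:ℝ) := by
    rw [hb, inner_sub_left, inner_smul_left, self1 ha]; simp
  have hab : ⟪a, b⟫ = (0:ℝ) := by rw [real_inner_comm]; exact hba
  have hae : ⟪a, e⟫ = (0:ℝ) := by
    rw [he, inner_sub_right, inner_add_right, inner_smul_right, inner_smul_right, self1 ha, hab,
      real_inner_comm]; ring
  have hbe : ⟪b, e⟫ = (0:ℝ) := by
    rw [he, inner_sub_right, inner_add_right, inner_smul_right, inner_smul_right, hba,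
      real_inner_self_eq_norm_sq, real_inner_comm]
    by_cases h : b = 0
    · simp [h]
    · have := norm_pos_iff.2 h
      field_simp; ring
  have hz' : z = b + (⟪z, a⟫ : ℝ) • a := by rw [hb]; simp
  have hze : ⟪z, e⟫ = (0:ℝ) := by
    rw [hz', inner_add_left, hbe, inner_smul_left, hae]; simp
  have hpe : (⟪p, e⟫ : ℝ) = ‖e‖ ^ 2 := by
    have : p = e + ((⟪p, a⟫ : ℝ) • a + ((⟪p, b⟫ : ℝ) / ‖b‖ ^ 2) • b) := by rw [he]; abel
    nth_rewrite 1 [this]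
    rw [inner_add_left, inner_add_left, inner_smul_left, inner_smul_left, hae, hbe,
      real_inner_self_eq_norm_sq]
    simp
  by_contra hne
  have he0 : e ≠ 0 := fun h => hne (sub_eq_zero.1 (he.symm.trans h))
  have hen := norm_pos_iff.2 he0
  have h1 := key1 hn hp hz ha hr (by rw [hpe]; positivity) hze hae hg hg_pos
  rw [scal hp hr hze hg h0] at h1
  exact lt_irrefl _ h1

lemma side {n : ℕ} (hn : 2 ≤ n) {p z a b : EE n} (hp : ‖p‖ = 1) (hz : ‖z‖ = 1) (ha : ‖a‖ = 1)
    {r : ℝ} (hr : r ∈ Set.Ioo 0 (π / 4)) (hb : b = z - (⟪z, a⟫ : ℝ) • a) (hb0 : b ≠ 0)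
    (hza : (⟪z, a⟫ : ℝ) < 0)
    {g : ℝ → ℝ} (hg : Continuous g) (hg_pos : ∀ t ∈ Set.Ioo (-1:ℝ) 1, 0 < g t)
    (h0 : ∫ v in gball n p r, g ⟪z, fold n a v⟫ • proj n z (fold n a v) ∂μH[(n:ℝ)] = 0) :
    0 < (⟪p, b⟫ : ℝ) := by
  have hpl := planar hn hp hz ha hr hb hg hg_pos h0
  by_contra hcon
  push Not at hcon
  obtain ⟨hcr, hcr2⟩ := cos_bd hr
  have hbn := norm_pos_iff.2 hb0
  have hba : ⟪b, a⟫ = (0:ℝ) := by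
    rw [hb, inner_sub_left, inner_smul_left, self1 ha]; simp
  have hab : ⟪a, b⟫ = (0:ℝ) := by rw [real_inner_comm]; exact hba
  obtain ⟨c, hc⟩ : ∃ c : ℝ, c = - ⟪z, a⟫ := ⟨_, rfl⟩
  have hc0 : 0 < c := by linarith
  have hza' : (⟪z, a⟫ : ℝ) = -c := by linarith
  have haz : (⟪a, z⟫ : ℝ) = -c := by rw [real_inner_comm]; exact hza'
  have hbsq : ‖b‖ ^ 2 = 1 - c ^ 2 := by
    rw [hb, norm_sub_sq_real, inner_smul_right, norm_smul, hza', ha, hz, mul_one,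
      Real.norm_eq_abs, sq_abs]; ring
  have hz' : z = b - c • a := by rw [hb, hza']; module
  obtain ⟨e, he⟩ : ∃ e : EE n, e = -(a + c • z) := ⟨_, rfl⟩
  have hze : ⟪z, e⟫ = (0:ℝ) := by
    rw [he, inner_neg_right, inner_add_right, inner_smul_right, self1 hz, hza']; ring
  have hev : ∀ v, (⟪e, v⟫ : ℝ) = -(‖b‖ ^ 2 * ⟪a, v⟫) - c * ⟪b, v⟫ := by
    intro v
    have : e = - ((1 - c ^ 2) • a + c • b) := by rw [he, hz']; module
    rw [this, inner_neg_left, inner_add_left, inner_smul_left, inner_smul_left, hbsq]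
    simp; ring
  have hsc := scal (e := e) hp hr hze hg h0
  have hfc := fold_cont a
  have hBv : ∀ v ∈ gball n p r, ‖v‖ = 1 ∧ 0 < (⟪p, v⟫ : ℝ) ∧ 1 < 2 * (⟪p, v⟫ : ℝ) ^ 2 := by
    intro v hv
    rw [mem_gball hr] at hv
    exact ⟨hv.1, hcr.trans hv.2, by nlinarith [hv.2]⟩
  by_cases hbig : ‖b‖ ^ 2 ≤ 2 * (⟪p, b⟫ : ℝ) ^ 2
  · have : 0 < ∫ v in gball n p r, g ⟪z, fold n a v⟫ * ⟪e, fold n a v⟫ ∂μH[(n:ℝ)] := by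
      refine pos_int hp hr (gball_meas p hr) le_rfl (by fun_prop) ?_
        (U := {v | Real.cos r < ⟪p, v⟫}) (isOpen_lt continuous_const (by fun_prop)) (v := p) ?_ hp ?_
      · intro v hv
        obtain ⟨hv1, hv2, hv3⟩ := hBv v hv
        have hbv := acute (x := -b) hp hv1 (neg_ne_zero.2 hb0)
          (by rw [inner_neg_right]; linarith) (by rw [inner_neg_right, norm_neg, neg_sq]; exact hbig)
          hv2 hv3
        rw [inner_neg_left] at hbv
        have hpos : 0 < (⟪e, fold n a v⟫ : ℝ) := by
          rw [hev, fold_inner_a ha, fold_inner_perp hba]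
          have h1 : 0 ≤ ‖b‖ ^ 2 * |(⟪a, v⟫ : ℝ)| := by positivity
          nlinarith
        exact mul_pos (hg_pos _ (strict_in hz (by rw [fold_norm ha, hv1]) hze hpos.ne')) hpos
      · change Real.cos r < ⟪p, p⟫
        rw [self1 hp]
        have := Real.cos_lt_cos_of_nonneg_of_le_pi (le_refl 0)
          (by linarith [hr.2, Real.pi_pos] : r ≤ π) hr.1
        simpa using this
      · rintro x ⟨hx1, hx2⟩
        exact (mem_gball hr).2 ⟨hx2, hx1⟩
    linarith
  · push Not at hbig
    have hpa2 : ‖a‖ ^ 2 ≤ 2 * (⟪p, a⟫ : ℝ) ^ 2 := by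
      have h1 : (⟪p, p⟫ : ℝ) = ⟪p, a⟫ ^ 2 + ⟪p, b⟫ ^ 2 / ‖b‖ ^ 2 := by
        nth_rewrite 2 [hpl]
        rw [inner_add_right, inner_smul_right, inner_smul_right]; ring
      rw [self1 hp] at h1
      have h2 : (⟪p, b⟫ : ℝ) ^ 2 / ‖b‖ ^ 2 ≤ 1 / 2 := by
        rw [div_le_div_iff₀ (by positivity) (by norm_num)]; linarith
      rw [ha]; linarith
    have ha0 : a ≠ 0 := by rintro rfl; simp at ha
    rcases lt_trichotomy (⟪p, a⟫ : ℝ) 0 with hpa | hpa | hpa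
    · have hcongr : ∀ v ∈ gball n p r, g ⟪z, fold n a v⟫ * ⟪e, fold n a v⟫ = g ⟪z, v⟫ * ⟪e, v⟫ := by
        intro v hv
        obtain ⟨hv1, hv2, hv3⟩ := hBv v hv
        have hbv := acute (x := -a) hp hv1 (neg_ne_zero.2 ha0)
          (by rw [inner_neg_right]; linarith) (by rw [inner_neg_right, norm_neg, neg_sq]; exact hpa2)
          hv2 hv3
        rw [inner_neg_left, real_inner_comm] at hbv
        have : fold n a v = v := by
          unfold fold; rw [if_neg (by linarith)]
        rw [this]
      rw [setIntegral_congr_fun (gball_meas p hr) hcongr] at hsc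
      have hpe : 0 < (⟪p, e⟫ : ℝ) := by
        rw [real_inner_comm, hev, real_inner_comm, real_inner_comm p b]
        have : 0 < ‖b‖ ^ 2 * -(⟪p, a⟫ : ℝ) := mul_pos (by positivity) (by linarith)
        nlinarith
      have := key2 hn hp hz hr hpe hze hg hg_pos
      linarith
    · rw [hpa, ha] at hpa2; norm_num at hpa2
    · have hrs : ∀ x y : EE n, (⟪x, rf a y⟫ : ℝ) = ⟪rf a x, y⟫ := by
        intro x y
        rw [← LinearIsometryEquiv.inner_map_map (rf a) x, rf_rf]
      have hcongr : ∀ v ∈ gball n p r,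
          g ⟪z, fold n a v⟫ * ⟪e, fold n a v⟫ = g ⟪rf a z, v⟫ * ⟪rf a e, v⟫ := by
        intro v hv
        obtain ⟨hv1, hv2, hv3⟩ := hBv v hv
        have hbv := acute (x := a) hp hv1 ha0 hpa.le hpa2 hv2 hv3
        rw [real_inner_comm] at hbv
        have : fold n a v = rf a v := by
          unfold fold sphRefl; rw [if_pos hbv, rf_apply, ha, real_inner_comm]; simp
        rw [this, hrs, hrs]
      rw [setIntegral_congr_fun (gball_meas p hr) hcongr] at hsc
      have hpe : 0 < (⟪p, rf a e⟫ : ℝ) := by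
        rw [hrs, real_inner_comm, hev, rf_inner_self ha0, rf_inner_perp hba, real_inner_comm,
          real_inner_comm p b]
        have : 0 < ‖b‖ ^ 2 * (⟪p, a⟫ : ℝ) := mul_pos (by positivity) (by linarith)
        nlinarith
      have := key2 (z := rf a z) hn hp (by rw [LinearIsometryEquiv.norm_map, hz]) hr hpe
        (by rw [LinearIsometryEquiv.inner_map_map, hze]) hg hg_pos
      linarith

lemma vanish {n : ℕ} {p z a : EE n} {r : ℝ} (hr : r ∈ Set.Ioo 0 (π / 4)) (hz : ‖z‖ = 1)
    (haz : a = -z) (hpz : p = z ∨ p = -z) (g : ℝ → ℝ) :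
    ∫ v in gball n p r, g ⟪z, fold n a v⟫ • proj n z (fold n a v) ∂μH[(n:ℝ)] = 0 := by
  let T : EE n ≃ₗᵢ[ℝ] EE n := (ℝ ∙ z).reflection
  have hT : ∀ v, T v = (2 * ⟪z, v⟫ : ℝ) • z - v := by
    intro v
    simp only [T]
    rw [Submodule.reflection_singleton_apply, hz]
    simp [two_smul]; module
  have hTz : ∀ v, (⟪z, T v⟫ : ℝ) = ⟪z, v⟫ := by
    intro v
    rw [hT, inner_sub_right, inner_smul_right, self1 hz]; ring
  have hTp : ∀ v, (⟪p, T v⟫ : ℝ) = ⟪p, v⟫ := by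
    intro v
    rcases hpz with h | h
    · rw [h, hTz]
    · rw [h, inner_neg_left, inner_neg_left, hTz]
  refine antisymm_int T _ (gball_meas p hr) ?_ _ ?_
  · ext v
    rw [Set.mem_preimage, mem_gball hr, mem_gball hr, hTp, LinearIsometryEquiv.norm_map]
  · intro v _
    have hfT : fold n a (T v) = T (fold n a v) := by
      have hTa : T a = a := by
        rw [hT, haz, inner_neg_right, self1 hz]; module
      have : (⟪T v, a⟫ : ℝ) = ⟪v, a⟫ := by
        nth_rewrite 1 [← hTa]; exact LinearIsometryEquiv.inner_map_map T v a
      rw [fold_eq, fold_eq, map_sub, map_smul, hTa, this]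
    rw [hfT, hTz, ← smul_neg]
    congr 1
    unfold proj
    rw [real_inner_comm, hTz, hT, real_inner_comm z]
    module

/-- Let `r ∈ (0, π/4)`, `p ∈ Sⁿ`, `q = -p`. For `z ≠ w` on the sphere write
`a(z,w) = (w - z)/|w - z|`. The set of pairs `(z, w) ∈ Sⁿ × Sⁿ`, `z ≠ w`, for which both
`∫_{B_{p,r}} g(z·F_{a(z,w)} v) π_z(F_{a(z,w)} v) dv` and
`∫_{B_{q,r}} g(z·F_{a(z,w)} v) π_z(F_{a(z,w)} v) dv` vanish is exactly `{(p,q), (q,p)}`. -/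
theorem statement12 (n : ℕ) (hn : 2 ≤ n)
    (g : ℝ → ℝ) (hg_cont : ContinuousOn g (Set.Icc (-1) 1))
    (hg_even : ∀ t, g (-t) = g t)
    (hg_nonneg : ∀ t ∈ Set.Icc (-1:ℝ) 1, 0 ≤ g t)
    (hg_pos : ∀ t ∈ Set.Ioo (-1:ℝ) 1, 0 < g t)
    (r : ℝ) (hr : r ∈ Set.Ioo 0 (π / 4))
    (p q : EuclideanSpace ℝ (Fin (n + 1))) (hp : p ∈ sph n) (hq : q = -p) :
    {zw : EuclideanSpace ℝ (Fin (n + 1)) × EuclideanSpace ℝ (Fin (n + 1)) |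
        zw.1 ∈ sph n ∧ zw.2 ∈ sph n ∧ zw.1 ≠ zw.2 ∧
        (∫ v in gball n p r,
            g ⟪zw.1, fold n (‖zw.2 - zw.1‖⁻¹ • (zw.2 - zw.1)) v⟫ •
              proj n zw.1 (fold n (‖zw.2 - zw.1‖⁻¹ • (zw.2 - zw.1)) v) ∂μH[(n:ℝ)]) = 0 ∧
        (∫ v in gball n q r,
            g ⟪zw.1, fold n (‖zw.2 - zw.1‖⁻¹ • (zw.2 - zw.1)) v⟫ •
              proj n zw.1 (fold n (‖zw.2 - zw.1‖⁻¹ • (zw.2 - zw.1)) v) ∂μH[(n:ℝ)]) = 0} =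
      {(p, q), (q, p)} := by
  have hp1 : ‖p‖ = 1 := by simpa [sph] using hp
  have hneg : (-1:ℝ) ≤ 1 := by norm_num
  let gc : ℝ → ℝ := Set.IccExtend hneg (Set.restrict (Set.Icc (-1:ℝ) 1) g)
  have hgc : Continuous gc := (continuousOn_iff_continuous_restrict.1 hg_cont).Icc_extend'
  have hgc_eq : ∀ t ∈ Set.Icc (-1:ℝ) 1, g t = gc t := by
    intro t ht
    simp only [gc]
    rw [Set.IccExtend_of_mem _ _ ht]; rfl
  have hgc_pos : ∀ t ∈ Set.Ioo (-1:ℝ) 1, 0 < gc t := by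
    intro t ht
    rw [← hgc_eq t ⟨ht.1.le, ht.2.le⟩]; exact hg_pos t ht
  have hint : ∀ z a x : EE n, ‖z‖ = 1 → ‖a‖ = 1 →
      ∫ v in gball n x r, g ⟪z, fold n a v⟫ • proj n z (fold n a v) ∂μH[(n:ℝ)] =
      ∫ v in gball n x r, gc ⟪z, fold n a v⟫ • proj n z (fold n a v) ∂μH[(n:ℝ)] := by
    intro z a x hz ha
    refine setIntegral_congr_fun (gball_meas x hr) ?_
    intro v hv
    have hv1 := ((mem_gball hr).1 hv).1
    have h := abs_real_inner_le_norm z (fold n a v)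
    rw [fold_norm ha, hz, hv1, one_mul, abs_le] at h
    change g _ • _ = gc _ • _
    rw [hgc_eq _ h]
  have hback : ∀ z w : EE n, ‖z‖ = 1 → w = -z → z ≠ w ∧ ‖w - z‖⁻¹ • (w - z) = -z := by
    intro z w hz hw
    have h2 : w - z = (-2:ℝ) • z := by rw [hw]; module
    have hz0 : z ≠ 0 := by rintro rfl; simp at hz
    constructor
    · intro h
      have h3 : (-2:ℝ) • z = 0 := by rw [← h2, ← h, sub_self]
      rcases smul_eq_zero.1 h3 with h4 | h4
      · norm_num at h4
      · exact hz0 h4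
    · rw [h2, norm_smul, hz, smul_smul]
      norm_num
  ext ⟨z, w⟩
  simp only [Set.mem_setOf_eq, Set.mem_insert_iff, Set.mem_singleton_iff, Prod.mk.injEq]
  constructor
  · rintro ⟨hz, hw, hne, h1, h2⟩
    have hz1 : ‖z‖ = 1 := by simpa [sph] using hz
    have hw1 : ‖w‖ = 1 := by simpa [sph] using hw
    have hwz : 0 < ‖w - z‖ := norm_pos_iff.2 (sub_ne_zero.2 (Ne.symm hne))
    set k := ‖w - z‖ with hk
    set a := k⁻¹ • (w - z) with ha
    have ha1 : ‖a‖ = 1 := by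
      rw [ha, norm_smul, ← hk, Real.norm_of_nonneg (by positivity)]
      field_simp
    have hza : (⟪z, a⟫ : ℝ) < 0 := by
      have hksq : k ^ 2 = 2 - 2 * ⟪z, w⟫ := by
        rw [hk, norm_sub_sq_real, hz1, hw1, real_inner_comm]; ring
      rw [ha, inner_smul_right, inner_sub_right, self1 hz1]
      apply mul_neg_of_pos_of_neg (by positivity)
      have : 0 < k ^ 2 := by positivity
      linarith
    rw [hint z a _ hz1 ha1] at h1 h2
    have hq1 : ‖q‖ = 1 := by rw [hq, norm_neg, hp1]
    obtain ⟨b, hb⟩ : ∃ b : EE n, b = z - (⟪z, a⟫ : ℝ) • a := ⟨_, rfl⟩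
    have hb0 : b = 0 := by
      by_contra hb0
      have s1 := side hn hp1 hz1 ha1 hr hb hb0 hza hgc hgc_pos h1
      have s2 := side hn hq1 hz1 ha1 hr hb hb0 hza hgc hgc_pos h2
      rw [hq, inner_neg_left] at s2
      linarith
    have hpl := planar hn hp1 hz1 ha1 hr hb hgc hgc_pos h1
    rw [hb0, smul_zero, add_zero] at hpl
    rw [hb0] at hb
    have hz2 : z = (⟪z, a⟫ : ℝ) • a := (sub_eq_zero.1 hb.symm)
    have hza1 : (⟪z, a⟫ : ℝ) = -1 := by
      have h := congrArg norm hz2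
      rw [norm_smul, hz1, ha1, Real.norm_eq_abs, abs_of_neg hza] at h
      linarith
    have haz : z = -a := by rw [hza1] at hz2; rw [hz2]; module
    have hwk : w = (1 - k) • z := by
      have h : w - z = k • a := by
        rw [ha, smul_smul, mul_inv_cancel₀ hwz.ne', one_smul]
      have h' : w = z + k • a := by rw [← h]; abel
      have h'' : a = -z := by rw [haz, neg_neg]
      rw [h', h'']; module
    have hww : w = -z := by
      have h := congrArg norm hwk
      rw [norm_smul, hw1, hz1, Real.norm_eq_abs, mul_one] at h
      have hk2 : k = 2 := by
        rcases abs_cases (1 - k) with h3 | h3 <;> linarith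
      rw [hwk, hk2]; module
    have hpn : |(⟪p, a⟫ : ℝ)| = 1 := by
      have h := congrArg norm hpl
      rw [norm_smul, hp1, ha1, Real.norm_eq_abs] at h
      linarith
    rcases (abs_eq zero_le_one).1 hpn with h | h
    · right
      rw [h, one_smul] at hpl
      rw [hww, hq, haz, hpl]; simp
    · left
      rw [h] at hpl
      have : p = z := by rw [hpl, haz]; module
      rw [hww, hq, this]; simp
  · intro h
    have hz1 : ‖z‖ = 1 := by
      rcases h with ⟨h, -⟩ | ⟨h, -⟩
      · rw [h, hp1]
      · rw [h, hq, norm_neg, hp1]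
    have hww : w = -z := by
      rcases h with ⟨h, h'⟩ | ⟨h, h'⟩
      · rw [h, h', hq]
      · rw [h, h', hq, neg_neg]
    have hpz : p = z ∨ p = -z := by
      rcases h with ⟨h, h'⟩ | ⟨h, h'⟩
      · left; rw [h]
      · right; rw [h, hq, neg_neg]
    have hqz : q = z ∨ q = -z := by
      rcases h with ⟨h, h'⟩ | ⟨h, h'⟩
      · right; rw [h, hq]
      · left; rw [h]
    obtain ⟨hne, haz⟩ := hback z w hz1 hww
    refine ⟨by simpa [sph] using hz1, by rw [hww]; simpa [sph] using hz1, hne, ?_, ?_⟩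
    · exact vanish hr hz1 haz hpz g
    · exact vanish hr hz1 haz hqz g
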